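/- arXiv:math/0406133 — 2 statements merged into one kernel-verified Lean document; each statement's English description precedes it below -/
import Mathlib

section
/- Let k be a field of characteristic ≠ 2, let m ≥ 2, and let q₁ and q₂ be anisotropic m-fold Pfister forms over k. If q₂ becomes isotropic over the function field k(q₁) of the quadric of q₁, then q₁ and q₂ are similar (hence, being Pfister forms, isometric). -/
open scoped TensorProduct
open Quaternion
set_option synthInstance.maxHeartbeats 1000000
set_option maxHeartbeats 1000000
noncomputable section

universe u v

/-- Upper-triangular coefficient matrix of a quadratic form on `Fin n → R`. -/
def coeffMatrix {R : Type*} [CommRing R] {n : ℕ} (q : QuadraticForm R (Fin n → R)) :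
    Matrix (Fin n) (Fin n) R :=
  Matrix.of fun i j =>
    if i = j then q (Pi.single i 1)
    else if i < j then QuadraticMap.polar q (Pi.single i 1) (Pi.single j 1)
    else 0

/-- Base change of a quadratic form on `Fin n → R` along `R → l`. -/
def extendQF {R : Type*} [CommRing R] {n : ℕ} (q : QuadraticForm R (Fin n → R))
    (l : Type*) [CommRing l] [Algebra R l] : QuadraticForm l (Fin n → l) :=
  ((coeffMatrix q).map (algebraMap R l)).toQuadraticMap'

/-- Gram matrix of the polar bilinear form of `q`. -/
def polarMatrix {R : Type*} [CommRing R] {n : ℕ} (q : QuadraticForm R (Fin n → R)) :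
    Matrix (Fin n) (Fin n) R :=
  Matrix.of fun i j => QuadraticMap.polar q (Pi.single i 1) (Pi.single j 1)

/-- Discriminant: determinant of the Gram matrix (well defined up to squares). -/
def discQF {R : Type*} [CommRing R] {n : ℕ} (q : QuadraticForm R (Fin n → R)) : R :=
  (polarMatrix q).det

/-- Nondegeneracy (char ≠ 2): the Gram determinant is nonzero. -/
def NondegQF {R : Type*} [CommRing R] {n : ℕ} (q : QuadraticForm R (Fin n → R)) : Prop :=
  discQF q ≠ 0

/-- Two quadratic forms are similar if one is isometric to a unit scaling of the other. -/
def SimilarQF {R : Type*} [CommRing R] {n : ℕ} (q q' : QuadraticForm R (Fin n → R)) : Prop :=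
  ∃ c : R, IsUnit c ∧ QuadraticMap.Equivalent (c • q) q'

/-- The polynomial `q(X₁, …, X_{n-1}, 1)` defining the affine quadric. -/
def affineQuadricPoly {R : Type*} [CommRing R] {n : ℕ} (q : QuadraticForm R (Fin n → R)) :
    MvPolynomial (Fin (n - 1)) R :=
  (extendQF q (MvPolynomial (Fin (n - 1)) R))
    (fun i => if h : (i : ℕ) < n - 1 then MvPolynomial.X ⟨i, h⟩ else 1)

/-- Affine coordinate ring `R[x₁,…,x_{n-1}]/(q(x₁,…,x_{n-1},1))` of the quadric. -/
abbrev quadricCoordRing {R : Type*} [CommRing R] {n : ℕ}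
    (q : QuadraticForm R (Fin n → R)) : Type _ :=
  MvPolynomial (Fin (n - 1)) R ⧸ Ideal.span {affineQuadricPoly q}

/-- Function field `k(q)` of the quadric hypersurface `q = 0`. -/
abbrev quadricFunctionField {R : Type*} [CommRing R] {n : ℕ}
    (q : QuadraticForm R (Fin n → R)) : Type _ :=
  FractionRing (quadricCoordRing q)

/-- Affine coordinate ring `k[x,y]/(ax²+by²-1)` of the conic `C_{a,b}`. -/
abbrev conicCoordRing (k : Type*) [Field k] (a b : k) : Type _ :=
  MvPolynomial (Fin 2) k ⧸
    Ideal.span {(MvPolynomial.C a * MvPolynomial.X 0 ^ 2 +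
      MvPolynomial.C b * MvPolynomial.X 1 ^ 2 - 1 : MvPolynomial (Fin 2) k)}

/-- The conic function field `k(C_{a,b})`. -/
abbrev conicFunctionField (k : Type*) [Field k] (a b : k) : Type _ :=
  FractionRing (conicCoordRing k a b)

/-- A `k`-algebra is split if it is isomorphic to a matrix algebra over `k`. -/
def IsSplitAlg (k A : Type*) [Field k] [Ring A] [Algebra k A] : Prop :=
  ∃ n : ℕ, 0 < n ∧ Nonempty (A ≃ₐ[k] Matrix (Fin n) (Fin n) k)

/-- `A` is split by the extension `K/k`: the class of `A` lies in the Brauer kernel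
`κ(K/k) = ker (Br k → Br K)`. -/
def SplitsIn (k : Type*) [Field k] (A : Type*) [Ring A] [Algebra k A]
    (K : Type*) [CommRing K] [Algebra k K] : Prop :=
  ∃ n : ℕ, 0 < n ∧ Nonempty ((K ⊗[k] A) ≃ₐ[K] Matrix (Fin n) (Fin n) K)

/-- Brauer equivalence of two `k`-algebras. -/
def BrauerEquiv (k A B : Type*) [Field k] [Ring A] [Algebra k A] [Ring B] [Algebra k B] :
    Prop :=
  ∃ n m : ℕ, 0 < n ∧ 0 < m ∧
    Nonempty (Matrix (Fin n) (Fin n) A ≃ₐ[k] Matrix (Fin m) (Fin m) B)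

/-- A field is finitely generated (over its prime subfield). -/
def FieldFG (K : Type*) [Field K] : Prop :=
  ∃ s : Finset K, Subfield.closure (s : Set K) = ⊤

/-- Elementary equivalence in the first-order language of rings. -/
def ElemEquivRing (K₁ : Type*) (K₂ : Type*) [CommRing K₁] [CommRing K₂] : Prop :=
  letI := FirstOrder.Ring.compatibleRingOfRing K₁
  letI := FirstOrder.Ring.compatibleRingOfRing K₂
  FirstOrder.Language.ring.ElementarilyEquivalent K₁ K₂

/-- The `m`-fold Pfister form `⟨⟨a₁,…,aₘ⟩⟩ = ⟨1,a₁⟩ ⊗ ⋯ ⊗ ⟨1,aₘ⟩`. -/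
def pfisterForm {k : Type*} [Field k] {m : ℕ} (a : Fin m → k) :
    QuadraticForm k (Fin (2 ^ m) → k) :=
  QuadraticMap.weightedSumSquares k
    (fun j : Fin (2 ^ m) => ∏ i : Fin m, if Nat.testBit (j : ℕ) (i : ℕ) then a i else 1)

/-- The bilinear form `∑ cᵢ xᵢ yᵢ` with diagonal coefficients `c`. -/
def diagForm {R ι : Type*} [CommRing R] [Fintype ι] (c x y : ι → R) : R :=
  ∑ i, c i * x i * y i

/-- The diagonal form with coefficients `c` does not represent zero nontrivially. -/
def DiagAnisotropic {R ι : Type*} [CommRing R] [Fintype ι] (c : ι → R) : Prop :=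
  ∀ x, diagForm c x x = 0 → x = 0

section DiagForm

variable {R S ι : Type*} [CommRing R] [CommRing S] [Fintype ι]

theorem diagForm_comm (c x y : ι → R) : diagForm c x y = diagForm c y x :=
  Finset.sum_congr rfl fun _ _ => by ring

theorem diagForm_add_right (c x y z : ι → R) :
    diagForm c x (y + z) = diagForm c x y + diagForm c x z := by
  simp [diagForm, mul_add, Finset.sum_add_distrib]

theorem diagForm_sub_right (c x y z : ι → R) :
    diagForm c x (y - z) = diagForm c x y - diagForm c x z := by
  simp [diagForm, mul_sub, Finset.sum_sub_distrib]

theorem diagForm_smul_right (c x y : ι → R) (r : R) :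
    diagForm c x (r • y) = r * diagForm c x y := by
  simp only [diagForm, Finset.mul_sum, Pi.smul_apply, smul_eq_mul]
  exact Finset.sum_congr rfl fun _ _ => by ring

theorem diagForm_add_left (c x y z : ι → R) :
    diagForm c (x + y) z = diagForm c x z + diagForm c y z := by
  simp [diagForm, mul_add, add_mul, Finset.sum_add_distrib]

theorem diagForm_sub_left (c x y z : ι → R) :
    diagForm c (x - y) z = diagForm c x z - diagForm c y z := by
  simp [diagForm, mul_sub, sub_mul, Finset.sum_sub_distrib]

theorem diagForm_smul_left (c x y : ι → R) (r : R) :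
    diagForm c (r • x) y = r * diagForm c x y := by
  rw [diagForm_comm, diagForm_smul_right, diagForm_comm]

theorem diagForm_sum_right {κ : Type*} (s : Finset κ) (c x : ι → R) (y : κ → ι → R) :
    diagForm c x (∑ j ∈ s, y j) = ∑ j ∈ s, diagForm c x (y j) := by
  simp only [diagForm, Finset.sum_apply, Finset.mul_sum]
  exact Finset.sum_comm

theorem diagForm_sum_left {κ : Type*} (s : Finset κ) (c y : ι → R) (x : κ → ι → R) :
    diagForm c (∑ j ∈ s, x j) y = ∑ j ∈ s, diagForm c (x j) y := by
  simp only [diagForm_comm c _ y, diagForm_sum_right]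

theorem diagForm_map (σ : R →+* S) (c x y : ι → R) :
    diagForm (fun i => σ (c i)) (fun i => σ (x i)) (fun i => σ (y i)) = σ (diagForm c x y) := by
  simp [diagForm]

/-- Vectors over a fraction field have a common denominator. -/
theorem exists_common_denominator (A : Type*) {K : Type*} [CommRing A] [CommRing K]
    [Algebra A K] [IsFractionRing A K] (x : ι → K) :
    ∃ s ∈ nonZeroDivisors A, ∃ f : ι → A,
      ∀ i, algebraMap A K (f i) = algebraMap A K s * x i := by
  obtain ⟨s, hs⟩ := IsLocalization.exist_integer_multiples_of_finite (nonZeroDivisors A) x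
  choose f hf using hs
  exact ⟨s, s.2, f, fun i => by rw [hf, Algebra.smul_def]⟩

theorem DiagAnisotropic.fractionRing {A K : Type*} [CommRing A] [CommRing K]
    [Algebra A K] [IsFractionRing A K] {c : ι → A} (hc : DiagAnisotropic c) :
    DiagAnisotropic fun i => algebraMap A K (c i) := by
  intro x hx
  obtain ⟨s, hs, f, hf⟩ := exists_common_denominator A x
  have hfx : (fun i => algebraMap A K (f i)) = algebraMap A K s • x := funext hf
  have hf0 : f = 0 := hc f <| IsFractionRing.injective A K <| by
    rw [← diagForm_map, hfx, diagForm_smul_left, diagForm_smul_right, hx]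
    simp
  funext i
  have h := hf i
  rw [hf0, Pi.zero_apply, map_zero] at h
  exact ((IsLocalization.map_units K ⟨s, hs⟩).mul_right_eq_zero.mp h.symm)

open Polynomial in
theorem coeff_diagForm_C (c : ι → R) (f : ι → R[X]) (D : ℕ) (hf : ∀ i, (f i).natDegree ≤ D) :
    (diagForm (fun i => C (c i)) f f).coeff (2 * D) =
      diagForm c (fun i => (f i).coeff D) (fun i => (f i).coeff D) := by
  simp only [diagForm, finsetSum_coeff, mul_assoc, coeff_C_mul]
  refine Finset.sum_congr rfl fun i _ => ?_
  rw [two_mul, coeff_mul_add_eq_of_natDegree_le (hf i) (hf i)]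

open Polynomial in
/-- For an anisotropic form, leading coefficients do not cancel. -/
theorem DiagAnisotropic.natDegree_le {c : ι → R} (hc : DiagAnisotropic c) (f : ι → R[X]) (D : ℕ)
    (h : (diagForm (fun i => C (c i)) f f).natDegree ≤ 2 * D) (i : ι) : (f i).natDegree ≤ D := by
  set N := Finset.univ.sup fun i => (f i).natDegree with hN
  have hle : ∀ i, (f i).natDegree ≤ N := fun i =>
    Finset.le_sup (f := fun i => (f i).natDegree) (Finset.mem_univ i)
  by_contra! hi
  have hDN : D < N := hi.trans_le (hle i)
  have hcoeff := coeff_diagForm_C c f N hle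
  rw [coeff_eq_zero_of_natDegree_lt (by omega)] at hcoeff
  have hz := hc _ hcoeff.symm
  obtain ⟨j, -, hj⟩ := Finset.exists_mem_eq_sup Finset.univ ⟨i, Finset.mem_univ i⟩
    fun i => (f i).natDegree
  have hj0 : (f j).coeff N = 0 := congrFun hz j
  rw [hN, hj, coeff_natDegree, leadingCoeff_eq_zero] at hj0
  rw [← hN] at hj
  simp only [hj0, natDegree_zero] at hj
  omega

open Polynomial in
theorem DiagAnisotropic.polynomial {c : ι → R} (hc : DiagAnisotropic c) :
    DiagAnisotropic fun i => C (c i) := by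
  intro f hf
  have hdeg : ∀ i, (f i).natDegree ≤ 0 := hc.natDegree_le f 0 (by simp [hf])
  have hcoeff := coeff_diagForm_C c f 0 hdeg
  rw [hf, coeff_zero] at hcoeff
  have hz := hc _ hcoeff.symm
  funext i
  rw [eq_C_of_natDegree_le_zero (hdeg i), show (f i).coeff 0 = 0 from congrFun hz i]
  simp

theorem finSuccEquiv_C (n : ℕ) (r : R) :
    MvPolynomial.finSuccEquiv R n (MvPolynomial.C r) = Polynomial.C (MvPolynomial.C r) := by
  simp [MvPolynomial.finSuccEquiv_apply]

theorem DiagAnisotropic.mvPolynomial {c : ι → R} (hc : DiagAnisotropic c) (n : ℕ) :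
    DiagAnisotropic fun i => (MvPolynomial.C (c i) : MvPolynomial (Fin n) R) := by
  induction n with
  | zero =>
    intro f hf
    set e := MvPolynomial.isEmptyRingEquiv R (Fin 0)
    have he : ∀ r, e (MvPolynomial.C r) = r := fun r => by
      rw [← MvPolynomial.isEmptyRingEquiv_symm_apply]; exact e.apply_symm_apply r
    have h := diagForm_map (e : _ →+* R) (fun i => MvPolynomial.C (c i)) f f
    simp only [RingEquiv.coe_toRingHom, hf, map_zero, he] at h
    funext i
    exact e.injective (by rw [congrFun (hc _ h) i]; simp)
  | succ n ih =>
    intro f hf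
    have h := diagForm_map (MvPolynomial.finSuccEquiv R n :
      MvPolynomial (Fin (n + 1)) R →+* Polynomial (MvPolynomial (Fin n) R))
      (fun i => MvPolynomial.C (c i)) f f
    simp only [RingHom.coe_coe, hf, map_zero, finSuccEquiv_C] at h
    funext i
    exact (MvPolynomial.finSuccEquiv R n).injective (by rw [congrFun (ih.polynomial _ h) i]; simp)

end DiagForm

section CasselsPfister

open Polynomial

variable {ι : Type*} [Fintype ι]

/-- Leading coefficients turn a representation of a constant by polynomials into a
representation over the base ring. -/
theorem DiagAnisotropic.exists_of_polynomial {R : Type*} [CommRing R] [IsDomain R] {c : ι → R}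
    (hc : DiagAnisotropic c) (S : Set (ι → R)) (d : R) (f : ι → R[X]) (g : R[X]) (hg : g ≠ 0)
    (hS : ∀ v ∈ S, diagForm (fun i => C (c i)) (fun i => C (v i)) f = 0)
    (hfg : diagForm (fun i => C (c i)) f f = g ^ 2 * C d) :
    ∃ (f' : ι → R) (g' : R), g' ≠ 0 ∧ (∀ v ∈ S, diagForm c v f' = 0) ∧
      diagForm c f' f' = g' ^ 2 * d := by
  have hdeg : ∀ i, (f i).natDegree ≤ g.natDegree := hc.natDegree_le f _ <| by
    rw [hfg]
    refine natDegree_mul_C_le _ _ |>.trans ?_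
    rw [natDegree_pow]
  refine ⟨fun i => (f i).coeff g.natDegree, g.leadingCoeff, leadingCoeff_ne_zero.mpr hg, ?_, ?_⟩
  · intro v hv
    have h := congrArg (fun p => p.coeff g.natDegree) (hS v hv)
    simpa only [diagForm, finsetSum_coeff, mul_assoc, coeff_C_mul, coeff_zero] using h
  · rw [← coeff_diagForm_C c f _ hdeg, hfg, coeff_mul_C, two_mul, pow_two,
      coeff_mul_add_eq_of_natDegree_le le_rfl le_rfl, coeff_natDegree, pow_two]

theorem DiagAnisotropic.exists_of_mvPolynomial {k : Type*} [Field k] {c : ι → k}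
    (hc : DiagAnisotropic c) (S : Set (ι → k)) (d : k) (n : ℕ)
    (f : ι → MvPolynomial (Fin n) k) (g : MvPolynomial (Fin n) k) (hg : g ≠ 0)
    (hS : ∀ v ∈ S, diagForm (fun i => MvPolynomial.C (c i)) (fun i => MvPolynomial.C (v i)) f = 0)
    (hfg : diagForm (fun i => MvPolynomial.C (c i)) f f = g ^ 2 * MvPolynomial.C d) :
    ∃ w : ι → k, (∀ v ∈ S, diagForm c v w = 0) ∧ diagForm c w w = d := by
  induction n with
  | zero =>
    set e := MvPolynomial.isEmptyRingEquiv k (Fin 0)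
    have he : ∀ r, e (MvPolynomial.C r) = r := fun r => by
      rw [← MvPolynomial.isEmptyRingEquiv_symm_apply]; exact e.apply_symm_apply r
    have hg' : e g ≠ 0 := by simpa using hg
    refine ⟨(e g)⁻¹ • fun i => e (f i), fun v hv => ?_, ?_⟩
    · have h := diagForm_map (e : _ →+* k) (fun i => MvPolynomial.C (c i))
        (fun i => MvPolynomial.C (v i)) f
      simp only [RingEquiv.coe_toRingHom, hS v hv, map_zero, he] at h
      rw [diagForm_smul_right, h, mul_zero]
    · have h := diagForm_map (e : _ →+* k) (fun i => MvPolynomial.C (c i)) f f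
      simp only [RingEquiv.coe_toRingHom, hfg, map_mul, map_pow, he] at h
      rw [diagForm_smul_right, diagForm_smul_left, h]
      field_simp
  | succ n ih =>
    set σ := MvPolynomial.finSuccEquiv k n
    have hσ : ∀ r, σ (MvPolynomial.C r) = C (MvPolynomial.C r) := fun r =>
      finSuccEquiv_C n r
    obtain ⟨f', g', hg', hS', hfg'⟩ := (hc.mvPolynomial n).exists_of_polynomial
      ((fun v i => MvPolynomial.C (v i)) '' S) (MvPolynomial.C d) (fun i => σ (f i)) (σ g)
      (by simpa using hg) (by
        rintro _ ⟨v, hv, rfl⟩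
        have h := diagForm_map (σ : MvPolynomial (Fin (n + 1)) k →+* (MvPolynomial (Fin n) k)[X])
          (fun i => MvPolynomial.C (c i)) (fun i => MvPolynomial.C (v i)) f
        simpa only [RingHom.coe_coe, hS v hv, map_zero, hσ] using h) (by
        have h := diagForm_map (σ : MvPolynomial (Fin (n + 1)) k →+* (MvPolynomial (Fin n) k)[X])
          (fun i => MvPolynomial.C (c i)) f f
        simpa only [RingHom.coe_coe, hfg, map_mul, map_pow, hσ] using h)
    exact ih f' g' hg' (fun v hv => hS' _ ⟨v, hv, rfl⟩) hfg'

/-- The Cassels–Pfister theorem, for representations orthogonal to a set of constant vectors. -/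
theorem DiagAnisotropic.cassels_pfister {F : Type*} [Field F] {c : ι → F}
    (hc : DiagAnisotropic c) (S : Set (ι → F)) (p : F[X]) (f : ι → F[X]) (g : F[X]) (hg : g ≠ 0)
    (hS : ∀ v ∈ S, diagForm (fun i => C (c i)) (fun i => C (v i)) f = 0)
    (hfg : diagForm (fun i => C (c i)) f f = g ^ 2 * p) :
    ∃ h : ι → F[X], (∀ v ∈ S, diagForm (fun i => C (c i)) (fun i => C (v i)) h = 0) ∧
      diagForm (fun i => C (c i)) h h = p := by
  induction hN : g.natDegree using Nat.strong_induction_on generalizing f g with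
  | _ N ih =>
  set c' : ι → F[X] := fun i => C (c i)
  set h : ι → F[X] := fun i => f i / g
  set r : ι → F[X] := fun i => f i % g
  have hfr : f = g • h + r := funext fun i => (EuclideanDomain.div_add_mod (f i) g).symm
  have hrdeg : ∀ i, (r i).degree < g.degree := fun i => EuclideanDomain.mod_lt (f i) hg
  have hSh : ∀ v ∈ S, diagForm c' (fun i => C (v i)) h = 0 := by
    intro v hv
    have h0 := hS v hv
    rw [hfr, diagForm_add_right, diagForm_smul_right] at h0
    have hlt : (diagForm c' (fun i => C (v i)) r).degree < g.degree := by
      refine (degree_sum_le _ _).trans_lt ?_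
      refine (Finset.sup_lt_iff (bot_lt_iff_ne_bot.mpr (degree_eq_bot.not.mpr hg))).mpr
        fun i _ => ?_
      rw [← C_mul, ← smul_eq_C_mul]
      exact (degree_smul_le _ _).trans_lt (hrdeg i)
    by_contra hne
    have hdvd : g ∣ diagForm c' (fun i => C (v i)) r :=
      ⟨-diagForm c' (fun i => C (v i)) h, by linear_combination h0⟩
    have hz := eq_zero_of_dvd_of_degree_lt hdvd hlt
    rw [hz, add_zero] at h0
    exact (mul_ne_zero hg hne) h0
  by_cases hr0 : r = 0
  · refine ⟨h, hSh, ?_⟩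
    rw [hfr, hr0, add_zero, diagForm_smul_left, diagForm_smul_right] at hfg
    exact mul_left_cancel₀ (pow_ne_zero 2 hg) (by rw [← hfg]; ring)
  · set a := diagForm c' h h - p with ha
    set b := 2 * (diagForm c' h f - p * g) with hb
    have hgg : g * (a * g - b) = diagForm c' r r := by
      have : r = f - g • h := by rw [hfr]; abel
      rw [this]
      simp only [diagForm_sub_left, diagForm_sub_right, diagForm_smul_left, diagForm_smul_right,
        hfg, diagForm_comm c' f h, ha, hb]
      ring
    have hrr : diagForm c' r r ≠ 0 := fun h0 => hr0 (hc.polynomial r h0)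
    have hg' : a * g - b ≠ 0 := fun h0 => hrr (by rw [← hgg, h0, mul_zero])
    have hgpos : 0 < g.natDegree := by
      by_contra! h0
      obtain ⟨i, hi⟩ := Function.ne_iff.mp hr0
      have h1 := natDegree_lt_natDegree hi (hrdeg i)
      omega
    have hdeg : (a * g - b).natDegree < N := by
      have h1 : (g * (a * g - b)).natDegree < 2 * g.natDegree := by
        rw [hgg]
        have hle : (diagForm c' r r).natDegree ≤ 2 * (g.natDegree - 1) := by
          refine natDegree_sum_le_of_forall_le _ _ fun i _ => ?_
          have hi : (r i).natDegree ≤ g.natDegree - 1 := by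
            by_cases h0 : r i = 0
            · simp [h0]
            · have := natDegree_lt_natDegree h0 (hrdeg i)
              omega
          rw [mul_assoc]
          refine (natDegree_C_mul_le _ _).trans (natDegree_mul_le.trans ?_)
          omega
        omega
      rw [natDegree_mul hg hg'] at h1
      omega
    refine ih _ hdeg (a • f - b • h) (a * g - b) hg' (fun v hv => ?_) ?_ rfl
    · rw [diagForm_sub_right, diagForm_smul_right, diagForm_smul_right, hS v hv, hSh v hv]
      simp
    · simp only [diagForm_sub_left, diagForm_sub_right, diagForm_smul_left, diagForm_smul_right,
        hfg, diagForm_comm c' f h, ha, hb]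
      ring

end CasselsPfister

section Subform

variable {ι : Type*} [Fintype ι]

open Polynomial in
/-- An anisotropic form representing `d X² + e` over the rational function field contains the
binary form `⟨d, e⟩`. -/
theorem DiagAnisotropic.exists_binary_subform {F : Type*} [Field F] (h2 : (2 : F) ≠ 0)
    {c : ι → F} (hc : DiagAnisotropic c) (S : Set (ι → F)) (d e : F) (f : ι → F[X]) (g : F[X])
    (hg : g ≠ 0) (hS : ∀ v ∈ S, diagForm (fun i => C (c i)) (fun i => C (v i)) f = 0)
    (hfg : diagForm (fun i => C (c i)) f f = g ^ 2 * (C d * X ^ 2 + C e)) :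
    ∃ v u : ι → F, diagForm c v v = d ∧ diagForm c u u = e ∧ diagForm c u v = 0 ∧
      ∀ s ∈ S, diagForm c s v = 0 ∧ diagForm c s u = 0 := by
  obtain ⟨h, hSh, hh⟩ := hc.cassels_pfister S _ f g hg hS hfg
  have hdeg : ∀ i, (h i).natDegree ≤ 1 := hc.natDegree_le h 1 <| by
    rw [hh]
    compute_degree
  set v : ι → F := fun i => (h i).coeff 1
  set u : ι → F := fun i => (h i).coeff 0
  have hsplit : h = (X : F[X]) • (fun i => C (v i)) + fun i => C (u i) := by
    funext i
    have hi := eq_X_add_C_of_natDegree_le_one (hdeg i)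
    simp only [Pi.add_apply, Pi.smul_apply, smul_eq_mul, v, u]
    rw [mul_comm]
    exact hi
  have hquad : C (diagForm c v v) * X ^ 2 + C (2 * diagForm c u v) * X + C (diagForm c u u) =
      C d * X ^ 2 + C (0 : F) * X + C e := by
    have hh' := hh
    rw [hsplit] at hh'
    simp only [diagForm_add_left, diagForm_add_right, diagForm_smul_left, diagForm_smul_right,
      diagForm_map, diagForm_comm c v u] at hh'
    simp only [C_mul, C_0, map_ofNat]
    linear_combination hh'
  have hlin : ∀ a b c : F, (C a * X ^ 2 + C b * X + C c).coeff 0 = c ∧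
      (C a * X ^ 2 + C b * X + C c).coeff 1 = b ∧
      (C a * X ^ 2 + C b * X + C c).coeff 2 = a := fun a b c => by
    simp [coeff_X, coeff_C]
  have h0 := hlin (diagForm c v v) (2 * diagForm c u v) (diagForm c u u)
  rw [hquad] at h0
  have h1 := hlin d 0 e
  refine ⟨v, u, h0.2.2.symm.trans h1.2.2, h0.1.symm.trans h1.1, ?_, fun s hs => ⟨?_, ?_⟩⟩
  · exact (mul_eq_zero.mp (h0.2.1.symm.trans h1.2.1)).resolve_left h2
  · have := congrArg (fun p => p.coeff 1) (hSh s hs)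
    simpa only [diagForm, finsetSum_coeff, mul_assoc, coeff_C_mul, coeff_zero] using this
  · have := congrArg (fun p => p.coeff 0) (hSh s hs)
    simpa only [diagForm, finsetSum_coeff, mul_assoc, coeff_C_mul, coeff_zero] using this

/-- Reflecting `v` to `v₀` moves a vector orthogonal to `v` to one orthogonal to `v₀`. -/
theorem DiagAnisotropic.exists_orthogonal {F : Type*} [Field F] {c : ι → F}
    (hc : DiagAnisotropic c) (S : Set (ι → F)) (v v₀ u : ι → F)
    (hv : diagForm c v v = diagForm c v₀ v₀) (huv : diagForm c u v = 0)
    (hSv : ∀ s ∈ S, diagForm c s v = 0) (hSv₀ : ∀ s ∈ S, diagForm c s v₀ = 0)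
    (hSu : ∀ s ∈ S, diagForm c s u = 0) :
    ∃ u' : ι → F, diagForm c u' u' = diagForm c u u ∧ diagForm c v₀ u' = 0 ∧
      ∀ s ∈ S, diagForm c s u' = 0 := by
  by_cases hw : v - v₀ = 0
  · refine ⟨u, rfl, ?_, hSu⟩
    rw [← sub_eq_zero.mp hw, diagForm_comm, huv]
  · have hww : diagForm c (v - v₀) (v - v₀) ≠ 0 := fun h => hw (hc _ h)
    obtain ⟨w, hwv⟩ : ∃ w, w = v - v₀ := ⟨_, rfl⟩
    rw [← hwv] at hww
    refine ⟨u - (2 * diagForm c u w / diagForm c w w) • w, ?_, ?_, fun s hs => ?_⟩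
    · rw [diagForm_sub_left, diagForm_sub_right, diagForm_sub_right, diagForm_smul_left,
        diagForm_smul_left, diagForm_smul_right, diagForm_smul_right, diagForm_comm c w u]
      field_simp
      ring
    · rw [diagForm_sub_right, diagForm_smul_right]
      field_simp
      simp only [hwv, diagForm_sub_left, diagForm_sub_right, diagForm_comm c v₀ u,
        diagForm_comm c v₀ v, huv, hv]
      ring
    · have hsw : diagForm c s w = 0 := by
        rw [hwv, diagForm_sub_right, hSv s hs, hSv₀ s hs, sub_zero]
      rw [diagForm_sub_right, diagForm_smul_right, hsw, hSu s hs, mul_zero, sub_zero]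

/-- The Cassels–Pfister subform theorem: an anisotropic diagonal form which represents the
generic value `D₀ X₀² + ⋯ + Dₙ₋₁ Xₙ₋₁² + Dₙ` contains the form `⟨D₀, …, Dₙ⟩`. -/
theorem DiagAnisotropic.exists_subform {k : Type*} [Field k] (h2 : (2 : k) ≠ 0) {c : ι → k}
    (hc : DiagAnisotropic c) (n : ℕ) (D : Fin (n + 1) → k) (S : Set (ι → k))
    (f : ι → MvPolynomial (Fin n) k) (g : MvPolynomial (Fin n) k) (hg : g ≠ 0)
    (hS : ∀ v ∈ S, diagForm (fun i => MvPolynomial.C (c i)) (fun i => MvPolynomial.C (v i)) f = 0)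
    (hfg : diagForm (fun i => MvPolynomial.C (c i)) f f =
      g ^ 2 * (∑ i : Fin n, MvPolynomial.C (D i.castSucc) * MvPolynomial.X i ^ 2 +
        MvPolynomial.C (D (Fin.last n)))) :
    ∃ w : Fin (n + 1) → ι → k, (∀ i j, diagForm c (w i) (w j) = if i = j then D i else 0) ∧
      ∀ v ∈ S, ∀ i, diagForm c v (w i) = 0 := by
  induction n generalizing S with
  | zero =>
    obtain ⟨w, hSw, hw⟩ := hc.exists_of_mvPolynomial S (D (Fin.last 0)) 0 f g hg hS
      (by simpa using hfg)
    have : Subsingleton (Fin (0 + 1)) := inferInstanceAs (Subsingleton (Fin 1))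
    refine ⟨fun _ => w, fun i j => ?_, fun v hv _ => hSw v hv⟩
    rw [hw, if_pos (Subsingleton.elim i j), Subsingleton.elim i (Fin.last 0)]
  | succ n ih =>
    let F := FractionRing (MvPolynomial (Fin n) k)
    let φ : MvPolynomial (Fin n) k →+* F := algebraMap _ F
    have hφ : Function.Injective φ := IsFractionRing.injective _ F
    let τ : k →+* F := φ.comp MvPolynomial.C
    let σ : MvPolynomial (Fin (n + 1)) k →+* Polynomial F :=
      (Polynomial.mapRingHom φ).comp (MvPolynomial.finSuccEquiv k n :
        MvPolynomial (Fin (n + 1)) k →+* Polynomial (MvPolynomial (Fin n) k))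
    have hσ : Function.Injective σ :=
      (Polynomial.map_injective φ hφ).comp (MvPolynomial.finSuccEquiv k n).injective
    have hσC : ∀ r, σ (MvPolynomial.C r) = Polynomial.C (τ r) := fun r => by
      simp [σ, τ, finSuccEquiv_C]
    have hσ0 : σ (MvPolynomial.X 0) = Polynomial.X := by
      simp [σ, MvPolynomial.finSuccEquiv_X_zero]
    have hσs : ∀ i : Fin n, σ (MvPolynomial.X i.succ) = Polynomial.C (φ (MvPolynomial.X i)) :=
      fun i => by simp [σ, MvPolynomial.finSuccEquiv_X_succ]
    have hcF : DiagAnisotropic fun i => τ (c i) := (hc.mvPolynomial n).fractionRing (K := F)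
    have h2F : (2 : F) ≠ 0 := by
      rw [← map_ofNat τ 2]
      exact (map_ne_zero τ).mpr h2
    obtain ⟨v, u, hv, hu, huv, hSvu⟩ := hcF.exists_binary_subform h2F
      ((fun s i => τ (s i)) '' S) (τ (D 0))
      (φ (∑ i : Fin n, MvPolynomial.C (D i.castSucc.succ) * MvPolynomial.X i ^ 2 +
        MvPolynomial.C (D (Fin.last (n + 1))))) (fun i => σ (f i)) (σ g)
      (by simpa using hσ.ne hg)
      (by
        rintro _ ⟨s, hs, rfl⟩
        have h := diagForm_map σ (fun i => MvPolynomial.C (c i)) (fun i => MvPolynomial.C (s i)) f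
        simpa only [hS s hs, map_zero, hσC] using h)
      (by
        have h := diagForm_map σ (fun i => MvPolynomial.C (c i)) f f
        simp only [hσC] at h
        rw [h, hfg, Fin.sum_univ_succ]
        simp only [map_mul, map_add, map_pow, map_sum, hσC, hσ0, hσs, Fin.castSucc_zero,
          Fin.succ_castSucc, τ, RingHom.comp_apply]
        ring)
    obtain ⟨s, hs, f₁, hf₁⟩ := exists_common_denominator (MvPolynomial (Fin n) k) v
    have hf₁' : (fun i => φ (f₁ i)) = φ s • v := funext hf₁
    obtain ⟨v₀, hSv₀, hv₀⟩ := hc.exists_of_mvPolynomial S (D 0) n f₁ s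
      (nonZeroDivisors.ne_zero hs)
      (fun w hw => hφ (by
        rw [← diagForm_map, hf₁', diagForm_smul_right, map_zero]
        exact mul_eq_zero_of_right _ (hSvu _ ⟨w, hw, rfl⟩).1))
      (hφ (by
        rw [← diagForm_map, hf₁', diagForm_smul_right, diagForm_smul_left, map_mul, map_pow]
        change φ s * (φ s * diagForm (fun i => τ (c i)) v v) = _
        rw [hv, pow_two, mul_assoc]
        rfl))
    obtain ⟨u', hu', hv₀u', hSu'⟩ := hcF.exists_orthogonal ((fun s i => τ (s i)) '' S) v
      (fun i => τ (v₀ i)) u (by rw [hv, diagForm_map, hv₀]) huv (fun s hs => (hSvu s hs).1)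
      (by
        rintro _ ⟨s, hs, rfl⟩
        rw [diagForm_map, hSv₀ s hs, map_zero]) (fun s hs => (hSvu s hs).2)
    obtain ⟨t, ht, f₂, hf₂⟩ := exists_common_denominator (MvPolynomial (Fin n) k) u'
    have hf₂' : (fun i => φ (f₂ i)) = φ t • u' := funext hf₂
    obtain ⟨w, hw, hSw⟩ := ih (fun i => D i.succ) (insert v₀ S) f₂ t (nonZeroDivisors.ne_zero ht)
      (fun w hw => hφ (by
        rw [← diagForm_map, hf₂', diagForm_smul_right, map_zero]
        rcases hw with rfl | hw
        · exact mul_eq_zero_of_right _ hv₀u'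
        · exact mul_eq_zero_of_right _ (hSu' _ ⟨w, hw, rfl⟩)))
      (hφ (by
        rw [← diagForm_map, hf₂', diagForm_smul_right, diagForm_smul_left, map_mul, map_pow]
        change φ t * (φ t * diagForm (fun i => τ (c i)) u' u') = _
        rw [hu', hu, pow_two, mul_assoc, Fin.succ_last]))
    refine ⟨Fin.cons v₀ w, fun i j => ?_, fun v hv i => ?_⟩
    · refine Fin.cases ?_ (fun i => ?_) i <;> refine Fin.cases ?_ (fun j => ?_) j
      · simpa using hv₀
      · simpa [(Fin.succ_ne_zero j).symm] using hSw v₀ (Set.mem_insert _ _) j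
      · simpa [diagForm_comm c (w i)] using hSw v₀ (Set.mem_insert _ _) i
      · simpa using hw i j
    · refine Fin.cases ?_ (fun i => ?_) i
      · simpa using hSv₀ v hv
      · simpa using hSw v (Set.mem_insert_of_mem _ hv) i

end Subform

section Pfister

/-- The diagonal coefficients of the Pfister form `⟨⟨a₁,…,aₘ⟩⟩`. -/
def pfisterWeight {R : Type*} [CommRing R] {m : ℕ} (a : Fin m → R) (j : Fin (2 ^ m)) : R :=
  ∏ i : Fin m, if Nat.testBit (j : ℕ) (i : ℕ) then a i else 1

theorem map_pfisterWeight {R S : Type*} [CommRing R] [CommRing S] (σ : R →+* S) {m : ℕ}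
    (a : Fin m → R) (j : Fin (2 ^ m)) :
    σ (pfisterWeight a j) = pfisterWeight (fun i => σ (a i)) j := by
  rw [pfisterWeight, map_prod, pfisterWeight]
  exact Finset.prod_congr rfl fun i _ => by split_ifs <;> simp

theorem diagForm_pfisterWeight_succ {R : Type*} [CommRing R] {m : ℕ} (a : Fin (m + 1) → R)
    (h : 2 ^ m + 2 ^ m = 2 ^ (m + 1)) (x : Fin (2 ^ m + 2 ^ m) → R) :
    diagForm (pfisterWeight a) (fun j => x (Fin.cast h.symm j)) (fun j => x (Fin.cast h.symm j)) =
      diagForm (pfisterWeight fun i => a i.castSucc) (fun i => x (Fin.castAdd _ i))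
        (fun i => x (Fin.castAdd _ i)) +
      a (Fin.last m) * diagForm (pfisterWeight fun i => a i.castSucc) (fun i => x (Fin.natAdd _ i))
        (fun i => x (Fin.natAdd _ i)) := by
  rw [diagForm, ← (finCongr h).sum_comp, Fin.sum_univ_add, diagForm, diagForm, Finset.mul_sum]
  refine congrArg₂ _ (Finset.sum_congr rfl fun j _ => ?_) (Finset.sum_congr rfl fun j _ => ?_)
  · have hw : pfisterWeight a (Fin.cast h (Fin.castAdd _ j)) =
        pfisterWeight (fun i => a i.castSucc) j := by
      rw [pfisterWeight, Fin.prod_univ_castSucc]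
      simp [pfisterWeight, Nat.testBit_lt_two_pow j.2]
    simp [hw]
  · have hw : pfisterWeight a (Fin.cast h (Fin.natAdd _ j)) =
        a (Fin.last m) * pfisterWeight (fun i => a i.castSucc) j := by
      rw [pfisterWeight, Fin.prod_univ_castSucc]
      simp [-Fin.natAdd_eq_addNat, pfisterWeight, Nat.testBit_two_pow_add_eq,
        Nat.testBit_lt_two_pow j.2, Nat.testBit_two_pow_add_gt, mul_comm]
    simp [-Fin.natAdd_eq_addNat, hw, mul_assoc]

/-- The set of values of a Pfister form over a field is closed under multiplication. -/
theorem exists_diagForm_pfisterWeight_mul {L : Type*} [Field L] {m : ℕ} (a : Fin m → L)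
    (x y : Fin (2 ^ m) → L) :
    ∃ z, diagForm (pfisterWeight a) z z =
      diagForm (pfisterWeight a) x x * diagForm (pfisterWeight a) y y := by
  induction m with
  | zero =>
    refine ⟨fun j => x j * y j, ?_⟩
    have : Unique (Fin (2 ^ 0)) := inferInstanceAs (Unique (Fin 1))
    simp only [diagForm, Fintype.sum_unique, pfisterWeight, Finset.univ_eq_empty,
      Finset.prod_empty]
    ring
  | succ m ih =>
    have h : 2 ^ m + 2 ^ m = 2 ^ (m + 1) := by ring
    have hsplit := fun x : Fin (2 ^ (m + 1)) → L =>
      diagForm_pfisterWeight_succ a h fun j => x (Fin.cast h j)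
    simp only [Fin.cast_cast, Fin.cast_eq_self] at hsplit
    have hjoin : ∀ z₁ z₂ : Fin (2 ^ m) → L, ∃ z, diagForm (pfisterWeight a) z z =
        diagForm (pfisterWeight fun i => a i.castSucc) z₁ z₁ +
          a (Fin.last m) * diagForm (pfisterWeight fun i => a i.castSucc) z₂ z₂ := fun z₁ z₂ =>
      ⟨_, (diagForm_pfisterWeight_succ a h (Fin.append z₁ z₂)).trans
        (by simp [-Fin.natAdd_eq_addNat])⟩
    rw [hsplit x, hsplit y]
    set c := pfisterWeight fun i => a i.castSucc
    set α := a (Fin.last m)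
    generalize (fun i => x (Fin.cast h (Fin.castAdd _ i))) = x₁
    generalize (fun i => x (Fin.cast h (Fin.natAdd _ i))) = x₂
    generalize (fun i => y (Fin.cast h (Fin.castAdd _ i))) = y₁
    generalize (fun i => y (Fin.cast h (Fin.natAdd _ i))) = y₂
    have hmul : ∀ x y, ∃ z, diagForm c z z = diagForm c x x * diagForm c y y :=
      ih fun i => a i.castSucc
    by_cases hs : diagForm c x₁ x₁ = 0
    · obtain ⟨z₁, hz₁⟩ := hmul x₂ y₁
      obtain ⟨z₂, hz₂⟩ := hmul x₂ y₂
      obtain ⟨z, hz⟩ := hjoin (α • z₂) z₁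
      refine ⟨z, ?_⟩
      rw [hz, diagForm_smul_left, diagForm_smul_right, hz₁, hz₂, hs]
      ring
    by_cases ht : diagForm c x₂ x₂ = 0
    · obtain ⟨z₁, hz₁⟩ := hmul x₁ y₁
      obtain ⟨z₂, hz₂⟩ := hmul x₁ y₂
      obtain ⟨z, hz⟩ := hjoin z₁ z₂
      refine ⟨z, ?_⟩
      rw [hz, hz₁, hz₂, ht]
      ring
    obtain ⟨w₀, hw₀⟩ := hmul x₁ x₂
    obtain ⟨w₁, hw₁⟩ := hmul w₀ y₂
    set s := diagForm c x₁ x₁ with hs_def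
    set t := diagForm c x₂ x₂ with ht_def
    set w := (s * t)⁻¹ • w₁ with hw_def
    have hw : s * t * diagForm c w w = diagForm c y₂ y₂ := by
      rw [hw_def, diagForm_smul_left, diagForm_smul_right, hw₁, hw₀]
      field_simp
    obtain ⟨z₁, hz₁⟩ := hmul x₁ (y₁ - (α * t) • w)
    obtain ⟨z₂, hz₂⟩ := hmul x₂ (y₁ + s • w)
    obtain ⟨z, hz⟩ := hjoin z₁ z₂
    refine ⟨z, ?_⟩
    rw [hz, hz₁, hz₂, ← hw, ← hs_def, ← ht_def]
    simp only [diagForm_sub_left, diagForm_sub_right, diagForm_add_left, diagForm_add_right,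
      diagForm_smul_left, diagForm_smul_right, diagForm_comm c w y₁]
    ring

end Pfister

section FunctionField

theorem weightedSumSquares_eq_diagForm {R ι : Type*} [CommRing R] [Fintype ι] (c x : ι → R) :
    QuadraticMap.weightedSumSquares R c x = diagForm c x x := by
  simp [QuadraticMap.weightedSumSquares_apply, diagForm, mul_assoc]

theorem extendQF_weightedSumSquares {R l : Type*} [CommRing R] [CommRing l] [Algebra R l] {n : ℕ}
    (c : Fin n → R) (x : Fin n → l) :
    extendQF (QuadraticMap.weightedSumSquares R c) l x =
      diagForm (fun i => algebraMap R l (c i)) x x := by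
  have hmat : coeffMatrix (QuadraticMap.weightedSumSquares R c) = Matrix.diagonal c := by
    ext i j
    rw [coeffMatrix, Matrix.of_apply, Matrix.diagonal_apply]
    split_ifs with hij hlt
    · rw [weightedSumSquares_eq_diagForm]
      simp [diagForm, Pi.single_apply]
    · simp only [QuadraticMap.polar, weightedSumSquares_eq_diagForm, diagForm_add_left,
        diagForm_add_right]
      simp [diagForm, Pi.single_apply, hij, Ne.symm hij]
    · rfl
  rw [extendQF, hmat, Matrix.diagonal_map (map_zero _)]
  change Matrix.toQuadraticForm' _ x = _
  simp only [Matrix.toQuadraticForm', LinearMap.BilinMap.toQuadraticMap_apply,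
    Matrix.toLinearMap₂'_apply', Matrix.mulVec_diagonal, dotProduct, diagForm]
  exact Finset.sum_congr rfl fun i _ => by ring

theorem affineQuadricPoly_weightedSumSquares {R : Type*} [CommRing R] (n : ℕ)
    (D : Fin (n + 1) → R) :
    affineQuadricPoly (QuadraticMap.weightedSumSquares R D) =
      (∑ i : Fin n, MvPolynomial.C (D i.castSucc) * MvPolynomial.X i ^ 2 +
        MvPolynomial.C (D (Fin.last n)) : MvPolynomial (Fin n) R) := by
  rw [affineQuadricPoly, extendQF_weightedSumSquares, diagForm, Fin.sum_univ_castSucc]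
  refine congrArg₂ _ (Finset.sum_congr rfl fun i _ => ?_) ?_
  · rw [dif_pos (by simp)]
    exact (mul_assoc _ _ _).trans (congrArg _ (pow_two _).symm)
  · rw [dif_neg (by simp), mul_one, mul_one]
    rfl

open Polynomial in
/-- If a monic quadratic `P` divides the value of an anisotropic form at `f`, and does not divide
`f`, then `P` is a quotient of two nonzero values of the form. -/
theorem DiagAnisotropic.exists_mul_of_dvd {B ι : Type*} [CommRing B] [IsDomain B] [Fintype ι]
    {c : ι → B} (hc : DiagAnisotropic c) (P : B[X]) (hP : P.Monic) (hdeg : P.natDegree = 2)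
    (f : ι → B[X]) (hdvd : P ∣ diagForm (fun i => C (c i)) f f) (hf : ∃ i, ¬ P ∣ f i) :
    ∃ u v : ι → B[X], diagForm (fun i => C (c i)) v v ≠ 0 ∧
      diagForm (fun i => C (c i)) u u = P * diagForm (fun i => C (c i)) v v := by
  set c' : ι → B[X] := fun i => C (c i)
  set r : ι → B[X] := fun i => f i %ₘ P
  set q : ι → B[X] := fun i => f i /ₘ P
  have hfr : f = r + P • q := funext fun i => (modByMonic_add_div (f i) P).symm
  have hP1 : P ≠ 1 := by rintro rfl; simp at hdeg
  have hr : ∀ i, (r i).natDegree ≤ 1 := fun i => by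
    have := natDegree_modByMonic_lt (f i) hP hP1
    simp only [r]
    omega
  have hdvd' : P ∣ diagForm c' r r := by
    rw [hfr] at hdvd
    simp only [diagForm_add_left, diagForm_add_right, diagForm_smul_left,
      diagForm_smul_right] at hdvd
    obtain ⟨e, he⟩ := hdvd
    exact ⟨e - diagForm c' q r - diagForm c' r q - P * diagForm c' q q, by
      linear_combination he⟩
  obtain ⟨e, he⟩ := hdvd'
  have hrr : diagForm c' r r ≠ 0 := fun h => by
    obtain ⟨i, hi⟩ := hf
    exact hi ((modByMonic_eq_zero_iff_dvd hP).mp (congrFun (hc.polynomial r h) i))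
  have he0 : e ≠ 0 := by
    rintro rfl
    exact hrr (by rw [he, mul_zero])
  have hdeg2 : (diagForm c' r r).natDegree ≤ 2 := by
    refine natDegree_sum_le_of_forall_le _ _ fun i _ => ?_
    rw [mul_assoc]
    refine (natDegree_C_mul_le _ _).trans (natDegree_mul_le.trans ?_)
    have := hr i
    omega
  have hedeg : e.natDegree = 0 := by
    rw [he, hP.natDegree_mul' he0, hdeg] at hdeg2
    omega
  have hcoeff := coeff_diagForm_C c r 1 hr
  have hlead : (diagForm c' r r).coeff (2 * 1) = e.coeff 0 := by
    rw [he, mul_one, eq_C_of_natDegree_eq_zero hedeg, coeff_mul_C, ← hdeg, coeff_natDegree, hP]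
    simp
  have hev : e = diagForm c' (fun i => C ((r i).coeff 1)) (fun i => C ((r i).coeff 1)) := by
    rw [diagForm_map, ← hcoeff, hlead]
    exact eq_C_of_natDegree_eq_zero hedeg
  exact ⟨r, fun i => C ((r i).coeff 1), hev ▸ he0, hev ▸ he⟩

theorem DiagAnisotropic.exists_mul_of_mvPolynomial_dvd {k ι : Type*} [Field k] [Fintype ι]
    {c : ι → k} (hc : DiagAnisotropic c) (n : ℕ) (D : Fin (n + 2) → k) (hD : D 0 = 1)
    (p : MvPolynomial (Fin (n + 1)) k)
    (hp : p = ∑ i : Fin (n + 1), MvPolynomial.C (D i.castSucc) * MvPolynomial.X i ^ 2 +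
        MvPolynomial.C (D (Fin.last (n + 1))))
    (f : ι → MvPolynomial (Fin (n + 1)) k)
    (hdvd : p ∣ diagForm (fun i => MvPolynomial.C (c i)) f f) (hf : ∃ i, ¬ p ∣ f i) :
    ∃ u v : ι → MvPolynomial (Fin (n + 1)) k,
      diagForm (fun i => MvPolynomial.C (c i)) v v ≠ 0 ∧
      diagForm (fun i => MvPolynomial.C (c i)) u u =
        p * diagForm (fun i => MvPolynomial.C (c i)) v v := by
  let σ := MvPolynomial.finSuccEquiv k n
  have hσ : ∀ x : ι → MvPolynomial (Fin (n + 1)) k,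
      diagForm (fun i => Polynomial.C (MvPolynomial.C (c i))) (fun i => σ (x i))
        (fun i => σ (x i)) = σ (diagForm (fun i => MvPolynomial.C (c i)) x x) := fun x => by
    have h := diagForm_map (σ : MvPolynomial (Fin (n + 1)) k →+* Polynomial (MvPolynomial (Fin n) k))
      (fun i => MvPolynomial.C (c i)) x x
    simpa only [RingHom.coe_coe, σ, finSuccEquiv_C] using h
  obtain ⟨δ, hδ⟩ : ∃ δ, σ p = Polynomial.X ^ 2 + Polynomial.C δ := by
    refine ⟨∑ i : Fin n, MvPolynomial.C (D i.succ.castSucc) * MvPolynomial.X i ^ 2 +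
      MvPolynomial.C (D (Fin.last (n + 1))), ?_⟩
    rw [hp, Fin.sum_univ_succ]
    simp only [map_add, map_mul, map_pow, map_sum, σ, finSuccEquiv_C,
      MvPolynomial.finSuccEquiv_X_zero, MvPolynomial.finSuccEquiv_X_succ, Fin.castSucc_zero, hD,
      map_one, one_mul, add_assoc]
  obtain ⟨u, v, hv, huv⟩ := (hc.mvPolynomial n).exists_mul_of_dvd (σ p)
    (by rw [hδ]; exact Polynomial.monic_X_pow_add_C δ two_ne_zero)
    (by rw [hδ]; exact Polynomial.natDegree_X_pow_add_C)
    (fun i => σ (f i)) (by rw [hσ]; exact map_dvd σ hdvd)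
    (by
      obtain ⟨i, hi⟩ := hf
      exact ⟨i, fun h => hi ((map_dvd_iff σ).mp h)⟩)
  have hu := hσ fun i => σ.symm (u i)
  have hv' := hσ fun i => σ.symm (v i)
  simp only [AlgEquiv.apply_symm_apply] at hu hv'
  refine ⟨fun i => σ.symm (u i), fun i => σ.symm (v i), ?_, ?_⟩
  · rw [hv'] at hv
    exact fun h => hv (by rw [h, map_zero])
  · exact σ.injective (by rw [← hu, map_mul, ← hv', huv])

/-- A multiplicative anisotropic form which becomes isotropic over the function field of the
quadric `⟨D₀, …⟩` with `D₀ = 1` contains the form `⟨D₀, …⟩`. -/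
theorem DiagAnisotropic.exists_subform_of_isotropic {k : Type u} [Field k] (h2 : (2 : k) ≠ 0)
    {N M n : ℕ} (hN : N = n + 2) {c : Fin M → k} (hc : DiagAnisotropic c) (D : Fin N → k)
    (hD : ∀ i : Fin N, (i : ℕ) = 0 → D i = 1)
    (hmul : ∀ {L : Type u} [Field L] (σ : k →+* L) (x y : Fin M → L), ∃ z,
      diagForm (fun i => σ (c i)) z z =
        diagForm (fun i => σ (c i)) x x * diagForm (fun i => σ (c i)) y y)
    (hiso : ¬ (extendQF (QuadraticMap.weightedSumSquares k c)
      (quadricFunctionField (QuadraticMap.weightedSumSquares k D))).Anisotropic) :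
    ∃ w : Fin N → Fin M → k, ∀ i j, diagForm c (w i) (w j) = if i = j then D i else 0 := by
  subst hN
  let A := MvPolynomial (Fin (n + 1)) k
  let p : A := affineQuadricPoly (QuadraticMap.weightedSumSquares k D)
  have hp : p = ∑ i : Fin (n + 1), MvPolynomial.C (D i.castSucc) * MvPolynomial.X i ^ 2 +
      MvPolynomial.C (D (Fin.last (n + 1))) := affineQuadricPoly_weightedSumSquares (n + 1) D
  let Q := A ⧸ Ideal.span {p}
  let K := FractionRing Q
  let π : A →+* Q := Ideal.Quotient.mk _
  have hπ : ∀ x, π x = 0 ↔ p ∣ x := fun x =>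
    Ideal.Quotient.eq_zero_iff_mem.trans Ideal.mem_span_singleton
  obtain ⟨x, hx, hx0⟩ : ∃ x : Fin M → K,
      diagForm (fun i => algebraMap Q K (π (MvPolynomial.C (c i)))) x x = 0 ∧ x ≠ 0 := by
    unfold QuadraticMap.Anisotropic at hiso
    push Not at hiso
    obtain ⟨x, hx, hx0⟩ := hiso
    rw [extendQF_weightedSumSquares] at hx
    exact ⟨x, hx, hx0⟩
  obtain ⟨s, hs, y, hy⟩ := exists_common_denominator Q x
  choose f hf using fun i => Ideal.Quotient.mk_surjective (y i)
  have hyx : (fun i => algebraMap Q K (y i)) = algebraMap Q K s • x := funext hy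
  obtain ⟨u, v, hv, huv⟩ := hc.exists_mul_of_mvPolynomial_dvd n D (hD 0 rfl) p hp f
    (by
      rw [← hπ, ← diagForm_map]
      refine IsFractionRing.injective Q K ?_
      have hπf : (fun i => π (f i)) = y := funext hf
      rw [hπf, ← diagForm_map, hyx, diagForm_smul_left, diagForm_smul_right, hx]
      simp)
    (by
      by_contra! h
      refine hx0 (funext fun i => ?_)
      have hyi : y i = 0 := (hf i).symm.trans ((hπ _).mpr (h i))
      have h0 := hy i
      rw [hyi, map_zero] at h0
      exact (IsLocalization.map_units K ⟨s, hs⟩).mul_right_eq_zero.mp h0.symm)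
  let L := FractionRing A
  let φ : A →+* L := algebraMap A L
  have hφ : Function.Injective φ := IsFractionRing.injective A L
  obtain ⟨z, hz⟩ := hmul (φ.comp MvPolynomial.C) (fun i => φ (u i)) (fun i => φ (v i))
  simp only [RingHom.comp_apply] at hz
  rw [diagForm_map, diagForm_map, huv, map_mul] at hz
  obtain ⟨t, ht, g, hg⟩ := exists_common_denominator A z
  have hgz : (fun i => φ (g i)) = φ t • z := funext hg
  obtain ⟨w, hw, -⟩ := hc.exists_subform h2 (n + 1) D ∅ g
    (t * diagForm (fun i => MvPolynomial.C (c i)) v v)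
    (mul_ne_zero (nonZeroDivisors.ne_zero ht) hv) (by simp)
    (hφ (by
      rw [← hp, ← diagForm_map, hgz, diagForm_smul_left, diagForm_smul_right, hz]
      simp only [map_mul, map_pow]
      ring))
  exact ⟨w, hw⟩

/-- An anisotropic diagonal form embeds isometrically along vectors with diagonal Gram matrix; in
equal dimensions this is an isometry. -/
theorem equivalent_of_gram {k : Type*} [Field k] {N : ℕ} {c D : Fin N → k}
    (hD : DiagAnisotropic D) (w : Fin N → Fin N → k)
    (hw : ∀ i j, diagForm c (w i) (w j) = if i = j then D i else 0) :
    QuadraticMap.Equivalent (QuadraticMap.weightedSumSquares k D)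
      (QuadraticMap.weightedSumSquares k c) := by
  let T : (Fin N → k) →ₗ[k] (Fin N → k) := Fintype.linearCombination k w
  have hT : ∀ x, diagForm c (T x) (T x) = diagForm D x x := fun x => by
    simp only [T, Fintype.linearCombination_apply, diagForm_sum_left, diagForm_sum_right,
      diagForm_smul_left, diagForm_smul_right, hw]
    simp only [mul_ite, mul_zero, Finset.sum_ite_eq', Finset.mem_univ, if_true, diagForm]
    exact Finset.sum_congr rfl fun i _ => by ring
  have hinj : Function.Injective T := (injective_iff_map_eq_zero T).mpr fun x hx =>
    hD x (by rw [← hT, hx]; simp [diagForm])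
  refine ⟨⟨LinearEquiv.ofInjectiveEndo T hinj, fun x => ?_⟩⟩
  rw [weightedSumSquares_eq_diagForm, weightedSumSquares_eq_diagForm]
  exact hT x

end FunctionField

theorem stmt_18 (k : Type u) [Field k] (h2 : (2 : k) ≠ 0) (m : ℕ) (hm : 2 ≤ m)
    (a b : Fin m → k) (ha : ∀ i, a i ≠ 0) (hb : ∀ i, b i ≠ 0)
    (han₁ : (pfisterForm a).Anisotropic) (han₂ : (pfisterForm b).Anisotropic)
    (hiso : ¬(extendQF (pfisterForm b) (quadricFunctionField (pfisterForm a))).Anisotropic) :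
    SimilarQF (pfisterForm a) (pfisterForm b) ∧
      QuadraticMap.Equivalent (pfisterForm a) (pfisterForm b) := by
  have hdiag : ∀ a : Fin m → k, (pfisterForm a).Anisotropic → DiagAnisotropic (pfisterWeight a) :=
    fun a h x hx => h x ((weightedSumSquares_eq_diagForm _ x).trans hx)
  obtain ⟨n, hn⟩ : ∃ n, 2 ^ m = n + 2 :=
    ⟨2 ^ m - 2, by have := Nat.pow_le_pow_right two_pos (one_le_two.trans hm); omega⟩
  obtain ⟨w, hw⟩ := (hdiag b han₂).exists_subform_of_isotropic h2 hn (pfisterWeight a)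
    (fun i hi => by simp [pfisterWeight, hi])
    (fun σ x y => by
      simp only [map_pfisterWeight]
      exact exists_diagForm_pfisterWeight_mul _ x y) hiso
  have heq : QuadraticMap.Equivalent (pfisterForm a) (pfisterForm b) :=
    equivalent_of_gram (hdiag a han₁) w hw
  exact ⟨⟨1, isUnit_one, by rwa [one_smul]⟩, heq⟩

end
end

section
/- (Colliot-Thélène) Let k be a field of characteristic ≠ 2 and a, b ∈ k×, and let C = C_{a,b} be the associated conic with affine coordinate ring A = k[x,y]/(ax² + by² − 1). Then the function field of the surface C × C, namely the fraction field of the integral domain A ⊗_k A, is isomorphic as a k-algebra to the rational function field k(C_{a,b})(t) in one variable over k(C_{a,b}). In particular, C × C is k-birational to C × ℙ¹. -/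
open scoped TensorProduct
open Quaternion
set_option synthInstance.maxHeartbeats 1000000
set_option maxHeartbeats 1000000
noncomputable section

universe u v

namespace ConicSquare

open Polynomial

/-- The polynomial `1 - a T²` is not `b` times the square of a rational function. -/
theorem eq_zero_of_C_mul_sq_eq {K : Type*} [Field K] (h2 : (2 : K) ≠ 0) {a b : K} (ha : a ≠ 0)
    (hb : b ≠ 0) {p q : K[X]} (h : C b * p ^ 2 = q ^ 2 * (1 - C a * X ^ 2)) : q = 0 := by
  by_contra hq
  have hCb : IsUnit (C b : K[X]) := isUnit_C.mpr hb.isUnit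
  have hdvd : q ^ 2 ∣ p ^ 2 := hCb.dvd_mul_left.mp ⟨_, h⟩
  obtain ⟨r, rfl⟩ := (IsIntegrallyClosed.pow_dvd_pow_iff two_ne_zero).mp hdvd
  have hr : C b * r ^ 2 = 1 - C a * X ^ 2 := by
    apply mul_left_cancel₀ (pow_ne_zero 2 hq)
    rw [← h]; ring
  have hsep : (1 - C a * X ^ 2 : K[X]).Separable := by
    refine ⟨1, C (-(2 : K)⁻¹) * X, ?_⟩
    have h2' : (C (2 : K)⁻¹ : K[X]) * 2 = 1 := by
      rw [show (2 : K[X]) = C 2 from rfl, ← C_mul, inv_mul_cancel₀ h2, C_1]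
    simp only [derivative_sub, derivative_one, derivative_mul, derivative_C, derivative_X_pow,
      C_neg]
    rw [show (2 : K[X]) = C 2 from rfl] at h2'
    norm_num
    linear_combination C a * X ^ 2 * h2'
  have hru : IsUnit r := hsep.squarefree r ⟨C b, by rw [← hr]; ring⟩
  have hdeg := congrArg natDegree hr
  obtain ⟨c, -, rfl⟩ := Polynomial.isUnit_iff.mp hru
  have hneg : (1 - C a * X ^ 2 : K[X]) = C (-a) * X ^ 2 + C 0 * X + C 1 := by
    simp; ring
  rw [hneg, natDegree_quadratic (neg_ne_zero.mpr ha), ← C_pow, ← C_mul, natDegree_C] at hdeg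
  omega

/-- On a conic point `(x, y)` with `x` transcendental, `1` and `y` are linearly independent
over the polynomials in `x`. -/
theorem eq_zero_of_aeval_add_aeval_mul_eq_zero {K L : Type*} [Field K] [Field L] [Algebra K L]
    (h2 : (2 : K) ≠ 0) {a b : K} (ha : a ≠ 0) (hb : b ≠ 0) {x y : L}
    (hxy : algebraMap K L a * x ^ 2 + algebraMap K L b * y ^ 2 = 1) (hx : Transcendental K x)
    {p q : K[X]} (h : aeval x p + aeval x q * y = 0) : p = 0 ∧ q = 0 := by
  have hinj := transcendental_iff_injective.mp hx
  have hq : q = 0 := by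
    refine eq_zero_of_C_mul_sq_eq h2 ha hb (p := p) (hinj ?_)
    simp only [map_mul, map_pow, map_sub, map_one, aeval_C, aeval_X]
    linear_combination algebraMap K L b * (aeval x p - aeval x q * y) * h
      + (aeval x q) ^ 2 * hxy
  subst hq
  exact ⟨hinj (by simpa using h), rfl⟩

/-- Projecting from a rational point of a conic: the line of transcendental slope `t` through
`(x₀, y₀)` meets the conic in a second point, whose first coordinate is transcendental. -/
theorem exists_point_on_line {K L : Type*} [Field K] [Field L] [Algebra K L]
    (h2 : (2 : K) ≠ 0) {a b x₀ y₀ : K} (hb : b ≠ 0)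
    (h₀ : a * x₀ ^ 2 + b * y₀ ^ 2 = 1) {t : L} (ht : Transcendental K t) :
    ∃ x y : L, algebraMap K L a * x ^ 2 + algebraMap K L b * y ^ 2 = 1 ∧ Transcendental K x ∧
      x - algebraMap K L x₀ ≠ 0 ∧ y - algebraMap K L y₀ = t * (x - algebraMap K L x₀) := by
  have hinj := transcendental_iff_injective.mp ht
  have hne {p : K[X]} (hp : p ≠ 0) : aeval t p ≠ 0 := (map_ne_zero_iff _ hinj).mpr hp
  have hden : algebraMap K L a + algebraMap K L b * t ^ 2 ≠ 0 := by
    have := hne (p := C a + C b * X ^ 2) fun h ↦ hb (by simpa using congrArg (coeff · 2) h)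
    simpa using this
  have hnum : algebraMap K L (a * x₀) + algebraMap K L (b * y₀) * t ≠ 0 := by
    have := hne (p := C (a * x₀) + C (b * y₀) * X) fun h ↦ by
      have h0 : a * x₀ = 0 := by simpa using congrArg (coeff · 0) h
      have h1 : b * y₀ = 0 := by simpa using congrArg (coeff · 1) h
      exact one_ne_zero (by linear_combination -h₀ + x₀ * h0 + y₀ * h1 : (1 : K) = 0)
    simpa using this
  have h2L : (2 : L) ≠ 0 := by
    rw [← map_ofNat (algebraMap K L) 2]
    exact (map_ne_zero_iff _ (algebraMap K L).injective).mpr h2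
  have h₀L : algebraMap K L a * algebraMap K L x₀ ^ 2
      + algebraMap K L b * algebraMap K L y₀ ^ 2 = 1 := by
    simpa using congrArg (algebraMap K L) h₀
  set s : L := -2 * (algebraMap K L (a * x₀) + algebraMap K L (b * y₀) * t) /
    (algebraMap K L a + algebraMap K L b * t ^ 2) with hs
  have hs0 : s ≠ 0 := div_ne_zero (mul_ne_zero (neg_ne_zero.mpr h2L) hnum) hden
  have hs' : s * (algebraMap K L a + algebraMap K L b * t ^ 2) =
      -2 * (algebraMap K L a * algebraMap K L x₀ + algebraMap K L b * algebraMap K L y₀ * t) := by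
    rw [hs, div_mul_cancel₀ _ hden, map_mul, map_mul]
  have hconic : algebraMap K L a * (algebraMap K L x₀ + s) ^ 2 +
      algebraMap K L b * (algebraMap K L y₀ + t * s) ^ 2 = 1 := by
    linear_combination h₀L + s * hs'
  refine ⟨algebraMap K L x₀ + s, algebraMap K L y₀ + t * s, hconic, fun hx ↦ ht ?_, by simpa,
    by ring⟩
  have hbL : algebraMap K L b ≠ 0 := (map_ne_zero_iff _ (algebraMap K L).injective).mpr hb
  have hsalg : IsAlgebraic K s := by
    simpa using hx.sub (isAlgebraic_algebraMap x₀)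
  have hyalg : IsAlgebraic K (algebraMap K L y₀ + t * s) := by
    refine IsAlgebraic.of_pow two_pos ?_
    have : (algebraMap K L y₀ + t * s) ^ 2 =
        (1 - algebraMap K L a * (algebraMap K L x₀ + s) ^ 2) * (algebraMap K L b)⁻¹ := by
      field_simp
      linear_combination hconic
    rw [this]
    exact (isAlgebraic_one.sub ((isAlgebraic_algebraMap a).mul (hx.pow 2))).mul
      (isAlgebraic_algebraMap b).inv
  have : t = (algebraMap K L y₀ + t * s - algebraMap K L y₀) * s⁻¹ := by
    field_simp; ring
  rw [this]
  exact (hyalg.sub (isAlgebraic_algebraMap y₀)).mul hsalg.inv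

section CoordRing

variable {k : Type*} [Field k] {a b : k}

variable (a b) in
/-- The coordinate functions of the affine conic. -/
abbrev coord (i : Fin 2) : conicCoordRing k a b := Ideal.Quotient.mk _ (MvPolynomial.X i)

theorem coord_eq : algebraMap k _ a * coord a b 0 ^ 2 + algebraMap k _ b * coord a b 1 ^ 2 = 1 := by
  rw [← sub_eq_zero]
  exact Ideal.Quotient.eq_zero_iff_mem.mpr (Ideal.mem_span_singleton_self _)

/-- A point of the conic with values in a `k`-algebra, as a homomorphism. -/
def pointHom {L : Type*} [CommRing L] [Algebra k L] (x y : L)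
    (h : algebraMap k L a * x ^ 2 + algebraMap k L b * y ^ 2 = 1) :
    conicCoordRing k a b →ₐ[k] L :=
  Ideal.Quotient.liftₐ _ (MvPolynomial.aeval ![x, y]) fun f hf ↦ by
    obtain ⟨g, rfl⟩ := Ideal.mem_span_singleton.mp hf
    simp [h]

theorem pointHom_coord {L : Type*} [CommRing L] [Algebra k L] (x y : L)
    (h : algebraMap k L a * x ^ 2 + algebraMap k L b * y ^ 2 = 1) (i : Fin 2) :
    pointHom x y h (coord a b i) = ![x, y] i :=
  MvPolynomial.aeval_X _ _

/-- The coordinate ring is generated by `1` and `y` over the polynomials in `x`. -/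
theorem exists_eq_aeval_add_aeval_mul (hb : b ≠ 0) (v : conicCoordRing k a b) :
    ∃ p q : k[X], v = aeval (coord a b 0) p + aeval (coord a b 0) q * coord a b 1 := by
  obtain ⟨f, rfl⟩ := Ideal.Quotient.mk_surjective v
  induction f using MvPolynomial.induction_on with
  | C c => exact ⟨C c, 0, by simp; rfl⟩
  | add f g hf hg =>
    obtain ⟨p, q, hf⟩ := hf
    obtain ⟨p', q', hg⟩ := hg
    exact ⟨p + p', q + q', by rw [map_add, hf, hg, map_add, map_add]; ring⟩
  | mul_X f i hf =>
    obtain ⟨p, q, hf⟩ := hf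
    rw [map_mul, hf]
    fin_cases i
    · exact ⟨p * X, q * X, by simp only [map_mul, aeval_X]; simp; ring⟩
    · refine ⟨q * (C b⁻¹ * (1 - C a * X ^ 2)), p, ?_⟩
      have hinv : algebraMap k (conicCoordRing k a b) b⁻¹ * algebraMap k _ b = 1 := by
        rw [← map_mul, inv_mul_cancel₀ hb, map_one]
      simp only [map_mul, map_sub, map_one, map_pow, aeval_X, aeval_C]
      change (_ + _ * coord a b 1) * coord a b 1 = _
      linear_combination
        algebraMap k _ b⁻¹ * aeval (coord a b 0) q * coord_eq (a := a) (b := b)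
          - aeval (coord a b 0) q * coord a b 1 ^ 2 * hinv

end CoordRing

/-- If `A` is generated by `1` and `y` over the polynomials in `x`, then `A ⊗ A` is generated by `1`
and `1 ⊗ y` over the polynomials in `1 ⊗ x` with coefficients in the first factor. -/
theorem exists_eq_aeval_tmul_add_aeval_tmul_mul {k A : Type*} [Field k] [CommRing A] [Algebra k A]
    {x y : A} (hspan : ∀ v : A, ∃ p q : k[X], v = aeval x p + aeval x q * y) (z : A ⊗[k] A) :
    ∃ p q : A[X], z = aeval (1 ⊗ₜ[k] x) p + aeval (1 ⊗ₜ[k] x) q * 1 ⊗ₜ[k] y := by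
  induction z using TensorProduct.induction_on with
  | zero => exact ⟨0, 0, by simp⟩
  | add z w hz hw =>
    obtain ⟨p, q, hz⟩ := hz
    obtain ⟨p', q', hw⟩ := hw
    exact ⟨p + p', q + q', by rw [hz, hw, map_add, map_add]; ring⟩
  | tmul u v =>
    obtain ⟨p, q, rfl⟩ := hspan v
    have key (r : k[X]) :
        (1 : A) ⊗ₜ[k] aeval x r = aeval (1 ⊗ₜ[k] x) (r.map (algebraMap k A)) := by
      rw [aeval_map_algebraMap]
      exact (aeval_algHom_apply (Algebra.TensorProduct.includeRight : A →ₐ[k] A ⊗[k] A) x r).symm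
    refine ⟨C u * p.map (algebraMap k A), C u * q.map (algebraMap k A), ?_⟩
    rw [map_mul, map_mul, ← key, ← key, aeval_C, Algebra.TensorProduct.algebraMap_apply,
      Algebra.algebraMap_self_apply]
    simp [TensorProduct.tmul_add]

/-- A homomorphism from `A ⊗ A`, with `A` generated by a conic point, that is the inclusion in an
extension `K` of `A` on the first factor, and a point with first coordinate transcendental over `K`
on the second, is injective. -/
theorem injective_of_transcendental {k A K L : Type*} [Field k] (h2 : (2 : k) ≠ 0) {a b : k}
    (ha : a ≠ 0) (hb : b ≠ 0) [CommRing A] [Algebra k A] {x y : A}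
    (hxy : algebraMap k A a * x ^ 2 + algebraMap k A b * y ^ 2 = 1)
    (hspan : ∀ v : A, ∃ p q : k[X], v = aeval x p + aeval x q * y)
    [Field K] [Algebra A K] [FaithfulSMul A K] [Algebra k K] [Field L] [Algebra K L] [Algebra k L]
    [IsScalarTower k K L] (φ : A ⊗[k] A →ₐ[k] L)
    (hφ : ∀ u, φ (u ⊗ₜ 1) = algebraMap K L (algebraMap A K u))
    (hx : Transcendental K (φ (1 ⊗ₜ x))) : Function.Injective φ := by
  have hA : Function.Injective (algebraMap A K) := FaithfulSMul.algebraMap_injective A K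
  have hk {c : k} (hc : c ≠ 0) : algebraMap k K c ≠ 0 :=
    (map_ne_zero_iff _ (algebraMap k K).injective).mpr hc
  have hφxy : algebraMap K L (algebraMap k K a) * φ (1 ⊗ₜ x) ^ 2 +
      algebraMap K L (algebraMap k K b) * φ (1 ⊗ₜ y) ^ 2 = 1 := by
    have := congrArg (φ.comp Algebra.TensorProduct.includeRight) hxy
    simpa only [map_add, map_mul, map_pow, map_one, AlgHom.commutes, AlgHom.comp_apply,
      Algebra.TensorProduct.includeRight_apply, IsScalarTower.algebraMap_apply k K L] using this
  have heval (r : A[X]) :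
      φ (aeval (1 ⊗ₜ[k] x) r) = aeval (φ (1 ⊗ₜ x)) (r.map (algebraMap A K)) := by
    rw [aeval_def, aeval_def, eval₂_map, ← AlgHom.coe_toRingHom, hom_eval₂]
    congr 1
    exact RingHom.ext hφ
  rw [injective_iff_map_eq_zero]
  intro z hz
  obtain ⟨p, q, rfl⟩ := exists_eq_aeval_tmul_add_aeval_tmul_mul hspan z
  rw [map_add, map_mul, heval, heval] at hz
  obtain ⟨hp, hq⟩ := eq_zero_of_aeval_add_aeval_mul_eq_zero
    (by rw [← map_ofNat (algebraMap k K) 2]; exact hk h2) (hk ha) (hk hb) hφxy hx hz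
  rw [Polynomial.map_eq_zero_iff hA] at hp hq
  simp [hp, hq]

/-- If a subfield of `K(t)` contains `K` and `t`, it is everything. -/
theorem subfield_eq_top {K L : Type*} [Field K] [Field L] [Algebra K[X] L] [IsFractionRing K[X] L]
    (S : Subfield L) (hC : ∀ c, algebraMap K[X] L (C c) ∈ S) (hX : algebraMap K[X] L X ∈ S) :
    S = ⊤ := by
  have hpoly (p : K[X]) : algebraMap K[X] L p ∈ S := by
    induction p using Polynomial.induction_on' with
    | add p q hp hq => rw [map_add]; exact add_mem hp hq
    | monomial n c =>
      rw [← C_mul_X_pow_eq_monomial, map_mul, map_pow]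
      exact mul_mem (hC c) (pow_mem hX n)
  refine eq_top_iff.mpr fun z _ ↦ ?_
  obtain ⟨p, q, -, rfl⟩ := IsFractionRing.div_surjective (A := K[X]) z
  exact div_mem (hpoly p) (hpoly q)

/-- The tensor square of a ring `A` presented by a conic point `(x, y)` has fraction field `K(t)`,
where `K` is the fraction field of `A`. -/
theorem nonempty_fractionRing_algEquiv {k A K L : Type*} [Field k] (h2 : (2 : k) ≠ 0) {a b : k}
    (ha : a ≠ 0) (hb : b ≠ 0) [CommRing A] [Algebra k A] {x y : A}
    (hxy : algebraMap k A a * x ^ 2 + algebraMap k A b * y ^ 2 = 1)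
    (hspan : ∀ v : A, ∃ p q : k[X], v = aeval x p + aeval x q * y)
    [Field K] [Algebra A K] [IsFractionRing A K] [Algebra k K] [IsScalarTower k A K]
    [Field L] [Algebra K[X] L] [IsFractionRing K[X] L] [Algebra K L] [IsScalarTower K K[X] L]
    [Algebra k L] [IsScalarTower k K L]
    (hlift : ∀ x' y' : L, algebraMap k L a * x' ^ 2 + algebraMap k L b * y' ^ 2 = 1 →
      ∃ f : A →ₐ[k] L, f x = x' ∧ f y = y') :
    Nonempty (FractionRing (A ⊗[k] A) ≃ₐ[k] L) := by
  have hk {c : k} (hc : c ≠ 0) : algebraMap k K c ≠ 0 :=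
    (map_ne_zero_iff _ (algebraMap k K).injective).mpr hc
  have h₀ :
      algebraMap k K a * algebraMap A K x ^ 2 + algebraMap k K b * algebraMap A K y ^ 2 = 1 := by
    have := congrArg (algebraMap A K) hxy
    simpa only [map_add, map_mul, map_pow, map_one,
      ← IsScalarTower.algebraMap_apply k A K] using this
  have ht : Transcendental K (algebraMap K[X] L X) :=
    (transcendental_algebraMap_iff (IsFractionRing.injective K[X] L)).mpr (transcendental_X K)
  obtain ⟨x', y', hxy', hx', hne, hline⟩ := exists_point_on_line
    (by rw [← map_ofNat (algebraMap k K) 2]; exact hk h2) (hk hb) h₀ ht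
  rw [← IsScalarTower.algebraMap_apply, ← IsScalarTower.algebraMap_apply] at hxy'
  obtain ⟨f, hfx, hfy⟩ := hlift x' y' hxy'
  let φ : A ⊗[k] A →ₐ[k] L := Algebra.TensorProduct.productMap
    ((IsScalarTower.toAlgHom k K L).comp (IsScalarTower.toAlgHom k A K)) f
  have hφ (u : A) : φ (u ⊗ₜ 1) = algebraMap K L (algebraMap A K u) := by simp [φ]
  have hφx : φ (1 ⊗ₜ x) = x' := by simp [φ, hfx]
  have hφy : φ (1 ⊗ₜ y) = y' := by simp [φ, hfy]
  have hinj : Function.Injective φ :=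
    have : FaithfulSMul A K :=
      (faithfulSMul_iff_algebraMap_injective A K).mpr (IsFractionRing.injective A K)
    injective_of_transcendental h2 ha hb hxy hspan φ hφ (by rwa [hφx])
  have hmem (z : A ⊗[k] A) : φ z ∈ Subfield.closure (φ.range.toSubring : Set L) :=
    Subfield.subset_closure ⟨z, rfl⟩
  have hC (c : K) : algebraMap K L c ∈ Subfield.closure (φ.range.toSubring : Set L) := by
    obtain ⟨u, v, -, rfl⟩ := IsFractionRing.div_surjective (A := A) c
    rw [map_div₀, ← hφ, ← hφ]
    exact div_mem (hmem _) (hmem _)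
  have htop : Subfield.closure (φ.range.toSubring : Set L) = ⊤ := by
    refine subfield_eq_top (K := K) _ (fun c ↦ ?_) ?_
    · rw [← algebraMap_eq, ← IsScalarTower.algebraMap_apply]
      exact hC c
    · rw [← mul_div_cancel_right₀ (algebraMap K[X] L X) hne, ← hline, ← hφx, ← hφy]
      exact div_mem (sub_mem (hmem _) (hC _)) (sub_mem (hmem _) (hC _))
  let _ : Algebra (A ⊗[k] A) L := φ.toRingHom.toAlgebra
  have : IsScalarTower k (A ⊗[k] A) L := IsScalarTower.of_algebraMap_eq fun c ↦ (φ.commutes c).symm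
  have : FaithfulSMul (A ⊗[k] A) L := (faithfulSMul_iff_algebraMap_injective _ _).mpr hinj
  have : IsFractionRing (A ⊗[k] A) L := IsFractionRing.of_field _ _ fun z ↦ by
    have hz : z ∈ Subfield.closure (φ.range.toSubring : Set L) := htop ▸ Subfield.mem_top z
    obtain ⟨_, hu, _, hv, rfl⟩ := Subfield.mem_closure_iff.mp hz
    rw [Subring.closure_eq] at hu hv
    obtain ⟨u, rfl⟩ := hu
    obtain ⟨v, rfl⟩ := hv
    exact ⟨u, v, rfl⟩
  exact ⟨(FractionRing.algEquiv (A ⊗[k] A) L).restrictScalars k⟩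

end ConicSquare

theorem stmt_19 (k : Type u) [Field k] (h2 : (2 : k) ≠ 0) (a b : k) (ha : a ≠ 0) (hb : b ≠ 0)
    (K : Type u) [Field K] [Algebra (conicCoordRing k a b) K]
    [IsFractionRing (conicCoordRing k a b) K] [Algebra k K]
    [IsScalarTower k (conicCoordRing k a b) K] :
    Nonempty (FractionRing (conicCoordRing k a b ⊗[k] conicCoordRing k a b) ≃ₐ[k]
      FractionRing (Polynomial K)) := by
  exact ConicSquare.nonempty_fractionRing_algEquiv h2 ha hb ConicSquare.coord_eq
    (ConicSquare.exists_eq_aeval_add_aeval_mul hb) (K := K) fun x y h ↦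
      ⟨ConicSquare.pointHom x y h, ConicSquare.pointHom_coord x y h 0,
        ConicSquare.pointHom_coord x y h 1⟩

end
end
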